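/- The symmetric bilinear form Q on ℝ^K ≅ ℝ⁹ is nondegenerate of signature (6,3): ℝ^K is a Q-orthogonal direct sum of a 6-dimensional subspace on which Q is positive definite and a 3-dimensional subspace on which Q is negative definite. -/

import Mathlib

open scoped Classical

/-!  The six sides of a hexagon, in cyclic order, are labelled by
`a, ā, b, b̄, c, c̄`, identified with `0, 1, 2, 3, 4, 5 : Fin 6`. -/

/-- Two sides of the hexagon are adjacent. -/
def AdjacentSide (s t : Fin 6) : Prop :=
  ((s : ℕ) + 1) % 6 = (t : ℕ) ∨ ((t : ℕ) + 1) % 6 = (s : ℕ)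

/-- A chord: an unordered pair of two non-adjacent sides of the hexagon. -/
def Chord : Type :=
  {p : Finset (Fin 6) // p.card = 2 ∧ ∀ s ∈ p, ∀ t ∈ p, s ≠ t → ¬ AdjacentSide s t}

noncomputable instance : Fintype Chord := by
  unfold Chord; infer_instance

/-- `u` lies strictly between `s` and `t` in the cyclic order (going from `s` to `t`). -/
def BtwArc (s t u : Fin 6) : Prop :=
  0 < ((u : ℕ) + 6 - (s : ℕ)) % 6 ∧ ((u : ℕ) + 6 - (s : ℕ)) % 6 < ((t : ℕ) + 6 - (s : ℕ)) % 6

/-- Two chords cross: they have no side in common, and the two sides of one lie in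
different arcs of the cyclic order determined by the two sides of the other. -/
def Crosses (k k' : Finset (Fin 6)) : Prop :=
  Disjoint k k' ∧ ∃ s t u v : Fin 6, k = {s, t} ∧ k' = {u, v} ∧ s ≠ t ∧ u ≠ v ∧
    (BtwArc s t u ↔ ¬ BtwArc s t v)

/-- The symmetric bilinear form `Q` on `ℝ^K`: `Q(k, k') = 1` if the chords `k, k'` cross
and `0` otherwise. -/
noncomputable def Qform (f g : Chord → ℝ) : ℝ :=
  ∑ k : Chord, ∑ k' : Chord, (if Crosses k.1 k'.1 then (1 : ℝ) else 0) * f k * g k'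

/-- The vector in `ℝ³` contributed by each side: `a, b, c` contribute `e₁, e₂, e₃` and
`ā, b̄, c̄` contribute `-e₁, -e₂, -e₃`. -/
def sideVec : Fin 6 → Fin 3 → ℝ :=
  ![![1, 0, 0], ![-1, 0, 0], ![0, 1, 0], ![0, -1, 0], ![0, 0, 1], ![0, 0, -1]]

/-- The boundary map `∂ : ℝ^K → ℝ³`. -/
noncomputable def bdry (f : Chord → ℝ) : Fin 3 → ℝ :=
  ∑ k : Chord, f k • (∑ s ∈ k.1, sideVec s)

/-- The length functional `λ : ℝ^K → ℝ` (the sum of the coordinates). -/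
noncomputable def lamFun (f : Chord → ℝ) : ℝ := ∑ k : Chord, f k

instance (s t : Fin 6) : Decidable (AdjacentSide s t) := by
  unfold AdjacentSide; infer_instance

instance (s t u : Fin 6) : Decidable (BtwArc s t u) := by
  unfold BtwArc; infer_instance

/-- The crossing relation for chords given as ordered pairs of sides. -/
def PairCrosses (p q : Fin 6 × Fin 6) : Prop :=
  (p.1 ≠ q.1 ∧ p.1 ≠ q.2 ∧ p.2 ≠ q.1 ∧ p.2 ≠ q.2) ∧
    (BtwArc p.1 p.2 q.1 ↔ ¬ BtwArc p.1 p.2 q.2)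

instance (p q : Fin 6 × Fin 6) : Decidable (PairCrosses p q) := by
  unfold PairCrosses; infer_instance

theorem PairCrosses.swap_left : ∀ {s t u v : Fin 6}, s ≠ t →
    PairCrosses (t, s) (u, v) → PairCrosses (s, t) (u, v) := by
  decide +kernel

theorem PairCrosses.swap_right {s t u v : Fin 6} (h : PairCrosses (s, t) (v, u)) :
    PairCrosses (s, t) (u, v) := by
  unfold PairCrosses at *
  tauto

theorem crosses_pair_iff {s t u v : Fin 6} (hst : s ≠ t) (huv : u ≠ v) :
    Crosses {s, t} {u, v} ↔ PairCrosses (s, t) (u, v) := by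
  have hdisj : ∀ {s t u v : Fin 6}, Disjoint ({s, t} : Finset (Fin 6)) {u, v} ↔
      (s ≠ u ∧ s ≠ v ∧ t ≠ u ∧ t ≠ v) := by
    intro s t u v
    simp only [Finset.disjoint_insert_left, Finset.disjoint_singleton_left, Finset.mem_insert,
      Finset.mem_singleton]
    tauto
  constructor
  · rintro ⟨hd, s', t', u', v', hk, hk', -, -, hb⟩
    have h : PairCrosses (s', t') (u', v') := ⟨hdisj.1 (hk ▸ hk' ▸ hd), hb⟩
    rw [← Finset.coe_inj, Finset.coe_pair, Finset.coe_pair, Set.pair_eq_pair_iff] at hk hk'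
    rcases hk with ⟨rfl, rfl⟩ | ⟨rfl, rfl⟩ <;> rcases hk' with ⟨rfl, rfl⟩ | ⟨rfl, rfl⟩
    · exact h
    · exact h.swap_right
    · exact h.swap_left hst
    · exact (h.swap_left hst).swap_right
  · exact fun h => ⟨hdisj.2 h.1, s, t, u, v, rfl, rfl, hst, huv, h.2⟩

/-- The endpoints of the nine chords: first the six chords `{m - 1, m + 1}`, then the three
chords joining opposite sides. -/
def chordEnds : Fin 9 → Fin 6 × Fin 6 :=
  ![(5, 1), (0, 2), (1, 3), (2, 4), (3, 5), (4, 0), (0, 3), (1, 4), (2, 5)]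

theorem chordEnds_ne : ∀ i, (chordEnds i).1 ≠ (chordEnds i).2 := by decide

/-- The enumeration of the chords by their endpoints. -/
def chord (i : Fin 9) : Chord :=
  ⟨{(chordEnds i).1, (chordEnds i).2}, by revert i; decide⟩

theorem chord_bijective : Function.Bijective chord := by
  constructor
  · intro i j h
    have h' : ({(chordEnds i).1, (chordEnds i).2} : Finset (Fin 6)) =
      {(chordEnds j).1, (chordEnds j).2} := congrArg Subtype.val h
    clear h
    revert i j
    decide +kernel
  · rintro ⟨p, hp, hadj⟩
    obtain ⟨x, y, hxy, rfl⟩ := Finset.card_eq_two.1 hp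
    have key : ∀ x y : Fin 6, x ≠ y → ¬ AdjacentSide x y →
        ∃ i, ({(chordEnds i).1, (chordEnds i).2} : Finset (Fin 6)) = {x, y} := by
      decide +kernel
    obtain ⟨i, hi⟩ := key x y hxy (hadj x (by simp) y (by simp) hxy)
    exact ⟨i, Subtype.ext hi⟩

/-- The chords are indexed by `Fin 9`. -/
noncomputable def chordEquiv : Fin 9 ≃ Chord := Equiv.ofBijective chord chord_bijective

theorem Qform_eq_sum (f g : Chord → ℝ) :
    Qform f g = ∑ i, ∑ j, (if PairCrosses (chordEnds i) (chordEnds j) then (1 : ℝ) else 0) *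
      f (chord i) * g (chord j) := by
  unfold Qform
  rw [← chordEquiv.sum_comp]
  refine Finset.sum_congr rfl fun i _ => ?_
  rw [← chordEquiv.sum_comp]
  refine Finset.sum_congr rfl fun j _ => ?_
  have h : Crosses (chord i).1 (chord j).1 ↔ PairCrosses (chordEnds i) (chordEnds j) :=
    crosses_pair_iff (chordEnds_ne i) (chordEnds_ne j)
  simp only [chordEquiv, Equiv.ofBijective_apply, h]

/-- The adjacency matrix of the crossing relation in the enumeration `chord`. -/
def crossingMatrix : Fin 9 → Fin 9 → ℕ :=
  ![![0, 1, 0, 0, 0, 1, 1, 0, 0],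
    ![1, 0, 1, 0, 0, 0, 0, 1, 0],
    ![0, 1, 0, 1, 0, 0, 0, 0, 1],
    ![0, 0, 1, 0, 1, 0, 1, 0, 0],
    ![0, 0, 0, 1, 0, 1, 0, 1, 0],
    ![1, 0, 0, 0, 1, 0, 0, 0, 1],
    ![1, 0, 0, 1, 0, 0, 0, 1, 1],
    ![0, 1, 0, 0, 1, 0, 1, 0, 1],
    ![0, 0, 1, 0, 0, 1, 1, 1, 0]]

theorem ite_pairCrosses : ∀ i j,
    (if PairCrosses (chordEnds i) (chordEnds j) then 1 else 0) = crossingMatrix i j := by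
  decide +kernel

theorem Qform_eq_crossingMatrix (f g : Chord → ℝ) :
    Qform f g = ∑ i, ∑ j, (crossingMatrix i j : ℝ) * f (chord i) * g (chord j) := by
  simp only [Qform_eq_sum, ← ite_pairCrosses, Nat.cast_ite, Nat.cast_one, Nat.cast_zero]

/-- Linear forms on `ℝ^K` whose weighted squares make up the positive part of `Q`. -/
def posCoords : (Chord → ℝ) →ₗ[ℝ] (Fin 6 → ℝ) where
  toFun f :=
    let x := fun i => f (chord i)
    ![(x 0 - x 3) + (x 1 - x 4),
      (x 0 - x 3) - (x 1 - x 4) - 2 * (x 2 - x 5),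
      x 0 + x 1 + x 2 + x 3 + x 4 + x 5 + x 6 + x 7 + x 8,
      x 6 + x 7 + x 8,
      (x 0 + x 3) - (x 1 + x 4),
      (x 0 + x 3) + (x 1 + x 4) - 2 * (x 2 + x 5)]
  map_add' f g := by
    ext i; fin_cases i <;> simp <;> ring
  map_smul' c f := by
    ext i; fin_cases i <;> simp <;> ring

/-- Linear forms on `ℝ^K` whose weighted squares make up the negative part of `Q`. -/
def negCoords : (Chord → ℝ) →ₗ[ℝ] (Fin 3 → ℝ) where
  toFun f :=
    let x := fun i => f (chord i)
    ![(x 0 - x 3) - (x 1 - x 4) + (x 2 - x 5),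
      (x 6 - x 0 - x 3) - (x 7 - x 1 - x 4),
      (x 6 - x 0 - x 3) + (x 7 - x 1 - x 4) - 2 * (x 8 - x 2 - x 5)]
  map_add' f g := by
    ext i; fin_cases i <;> simp <;> ring
  map_smul' c f := by
    ext i; fin_cases i <;> simp <;> ring

/-- The weights of the squares of `posCoords`. -/
noncomputable def posWeights : Fin 6 → ℝ := ![1 / 4, 1 / 12, 1 / 3, 1 / 3, 1 / 4, 1 / 12]

/-- The weights of the squares of `negCoords`. -/
noncomputable def negWeights : Fin 3 → ℝ := ![1 / 3, 1 / 2, 1 / 6]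

theorem posWeights_pos (i : Fin 6) : 0 < posWeights i := by
  fin_cases i <;> norm_num [posWeights]

theorem negWeights_pos (i : Fin 3) : 0 < negWeights i := by
  fin_cases i <;> norm_num [negWeights]

theorem Qform_eq_coords (f g : Chord → ℝ) :
    Qform f g = ∑ i, posWeights i * (posCoords f i * posCoords g i) -
      ∑ i, negWeights i * (negCoords f i * negCoords g i) := by
  rw [Qform_eq_crossingMatrix]
  simp [Fin.sum_univ_succ, crossingMatrix, posWeights, negWeights, posCoords, negCoords]
  ring

theorem coords_injective : Function.Injective (posCoords.prod negCoords) := by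
  rw [injective_iff_map_eq_zero]
  intro f hf
  obtain ⟨hp, hn⟩ := Prod.ext_iff.1 hf
  have p := fun i => congrFun hp i
  have n := fun i => congrFun hn i
  simp [Fin.forall_fin_succ, posCoords, negCoords] at p n
  obtain ⟨p0, p1, p2, p3, p4, p5⟩ := p
  obtain ⟨n0, n1, n2⟩ := n
  have h : ∀ i, f (chord i) = 0 := by
    intro i
    fin_cases i <;> simp <;> linarith
  funext k
  obtain ⟨i, rfl⟩ := chord_bijective.2 k
  exact h i

/-- The coordinates diagonalizing `Q`. -/
noncomputable def coords : (Chord → ℝ) ≃ₗ[ℝ] (Fin 6 → ℝ) × (Fin 3 → ℝ) :=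
  (posCoords.prod negCoords).linearEquivOfInjective coords_injective (by
    simp [← Fintype.card_congr chordEquiv])

theorem coords_apply (f : Chord → ℝ) : coords f = (posCoords f, negCoords f) := rfl

theorem sum_weight_mul_self_pos {n : ℕ} {w u : Fin n → ℝ} (hw : ∀ i, 0 < w i) (hu : u ≠ 0) :
    0 < ∑ i, w i * (u i * u i) := by
  obtain ⟨i, hi⟩ := Function.ne_iff.1 hu
  exact Finset.sum_pos' (fun j _ => mul_nonneg (hw j).le (mul_self_nonneg _))
    ⟨i, Finset.mem_univ i, mul_pos (hw i) (mul_self_pos.2 hi)⟩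

theorem posCoords_surjective : Function.Surjective posCoords := fun u =>
  ⟨coords.symm (u, 0), congrArg Prod.fst (coords.apply_symm_apply (u, 0))⟩

theorem negCoords_surjective : Function.Surjective negCoords := fun u =>
  ⟨coords.symm (0, u), congrArg Prod.snd (coords.apply_symm_apply (0, u))⟩

theorem eq_zero_of_coords {f : Chord → ℝ} (hp : posCoords f = 0) (hn : negCoords f = 0) :
    f = 0 :=
  coords.map_eq_zero_iff.1 (by rw [coords_apply, hp, hn]; rfl)

theorem almost_simple_geodesics_stmt15 :
    (∀ f : Chord → ℝ, (∀ g : Chord → ℝ, Qform f g = 0) → f = 0) ∧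
    ∃ P N : Submodule ℝ (Chord → ℝ),
      IsCompl P N ∧
      Module.finrank ℝ P = 6 ∧ Module.finrank ℝ N = 3 ∧
      (∀ f ∈ P, f ≠ 0 → 0 < Qform f f) ∧
      (∀ f ∈ N, f ≠ 0 → Qform f f < 0) ∧
      (∀ f ∈ P, ∀ g ∈ N, Qform f g = 0) := by
  have hcard : Module.finrank ℝ (Chord → ℝ) = 9 := by
    simp [← Fintype.card_congr chordEquiv]
  refine ⟨fun f hf => ?_, negCoords.ker, posCoords.ker, ?_, ?_, ?_, ?_, ?_, ?_⟩
  · apply eq_zero_of_coords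
    · by_contra h
      have hg := coords_apply (coords.symm (posCoords f, 0))
      rw [coords.apply_symm_apply, Prod.mk.injEq] at hg
      have hq := hf (coords.symm (posCoords f, 0))
      rw [Qform_eq_coords, ← hg.1, ← hg.2] at hq
      have := sum_weight_mul_self_pos posWeights_pos h
      simp at hq
      linarith
    · by_contra h
      have hg := coords_apply (coords.symm (0, negCoords f))
      rw [coords.apply_symm_apply, Prod.mk.injEq] at hg
      have hq := hf (coords.symm (0, negCoords f))
      rw [Qform_eq_coords, ← hg.1, ← hg.2] at hq
      have := sum_weight_mul_self_pos negWeights_pos h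
      simp at hq
      linarith
  · refine IsCompl.of_eq ((Submodule.eq_bot_iff _).2 fun f hf => eq_zero_of_coords hf.2 hf.1)
      ((Submodule.eq_top_iff').2 fun f => ?_)
    obtain ⟨g, hg⟩ : ∃ g, coords g = (posCoords f, 0) := coords.surjective _
    rw [coords_apply, Prod.mk.injEq] at hg
    refine Submodule.mem_sup.2 ⟨g, hg.2, f - g, ?_, add_sub_cancel g f⟩
    rw [LinearMap.mem_ker, map_sub, hg.1, sub_self]
  · have := negCoords.finrank_range_add_finrank_ker
    rw [LinearMap.range_eq_top.2 negCoords_surjective, finrank_top, hcard,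
      Module.finrank_fin_fun] at this
    omega
  · have := posCoords.finrank_range_add_finrank_ker
    rw [LinearMap.range_eq_top.2 posCoords_surjective, finrank_top, hcard,
      Module.finrank_fin_fun] at this
    omega
  · intro f hf hf0
    have h := sum_weight_mul_self_pos posWeights_pos fun h => hf0 (eq_zero_of_coords h hf)
    simpa [Qform_eq_coords, LinearMap.mem_ker.1 hf] using h
  · intro f hf hf0
    have h := sum_weight_mul_self_pos negWeights_pos fun h => hf0 (eq_zero_of_coords hf h)
    simpa [Qform_eq_coords, LinearMap.mem_ker.1 hf] using h
  · intro f hf g hg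
    simp [Qform_eq_coords, LinearMap.mem_ker.1 hf, LinearMap.mem_ker.1 hg]
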